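/- Let d = 2 and let v be a solution of the hodograph PDE on H₁ = {y : y₂ ≥ 0, |y| ≥ 1} with |∇v(y)| ≤ 1/2 for all y ∈ H₁. If v is bounded from below on H₁, then inf_{H₁} v = min_{∂B₁⁺} v; similarly, if v is bounded from above on H₁, then sup_{H₁} v = max_{∂B₁⁺} v. -/

import Mathlib

open Real Set Filter MeasureTheory

noncomputable section

/-- The last index of `Fin d`. -/
def lastIdx (d : ℕ) (hd : 0 < d) : Fin d := ⟨d - 1, by omega⟩

/-- The `i`-th partial derivative of `v` at `y`. -/
def gradC (d : ℕ) (v : EuclideanSpace ℝ (Fin d) → ℝ)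
    (y : EuclideanSpace ℝ (Fin d)) (i : Fin d) : ℝ :=
  fderiv ℝ v y (EuclideanSpace.single i 1)

/-- The `(i,j)` entry of the Hessian of `v` at `y`. -/
def hessC (d : ℕ) (v : EuclideanSpace ℝ (Fin d) → ℝ)
    (y : EuclideanSpace ℝ (Fin d)) (i j : Fin d) : ℝ :=
  fderiv ℝ (fun z => fderiv ℝ v z (EuclideanSpace.single i 1)) y (EuclideanSpace.single j 1)

/-- The squared euclidean norm of the tangential part `p'` of `p`. -/
def tangSq (d : ℕ) (hd : 0 < d) (p : Fin d → ℝ) : ℝ :=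
  ∑ m : Fin d, if m = lastIdx d hd then 0 else (p m) ^ 2

/-- The coefficient matrix `A(p)` of the hodograph PDE. -/
def hodA (d : ℕ) (hd : 0 < d) (p : Fin d → ℝ) (i j : Fin d) : ℝ :=
  if i = lastIdx d hd then
    (if j = lastIdx d hd then (1 + tangSq d hd p) / (1 + p (lastIdx d hd)) ^ 2
     else p j / (1 + p (lastIdx d hd)))
  else
    (if j = lastIdx d hd then p i / (1 + p (lastIdx d hd))
     else if i = j then 1 else 0)

/-- The boundary nonlinearity `N(p') = √(1 + |p'|²) - 1`. -/
def hodN (d : ℕ) (hd : 0 < d) (p : Fin d → ℝ) : ℝ :=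
  Real.sqrt (1 + tangSq d hd p) - 1

/-- The quantity `tr(A(∇v(y)) D²v(y))`. -/
def hodOp (d : ℕ) (hd : 0 < d) (v : EuclideanSpace ℝ (Fin d) → ℝ)
    (y : EuclideanSpace ℝ (Fin d)) : ℝ :=
  ∑ i : Fin d, ∑ j : Fin d, hodA d hd (fun m => gradC d v y m) i j * hessC d v y i j

/-- `v` is `C^∞` on an open neighborhood of `U`. -/
def SmoothNear (d : ℕ) (v : EuclideanSpace ℝ (Fin d) → ℝ)
    (U : Set (EuclideanSpace ℝ (Fin d))) : Prop :=
  ∃ W : Set (EuclideanSpace ℝ (Fin d)), IsOpen W ∧ U ⊆ W ∧ ContDiffOn ℝ (⊤ : ℕ∞) v W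

/-- `v` is a (classical) solution of the hodograph PDE on `U`. -/
def IsHodSol (d : ℕ) (hd : 0 < d) (v : EuclideanSpace ℝ (Fin d) → ℝ)
    (U : Set (EuclideanSpace ℝ (Fin d))) : Prop :=
  SmoothNear d v U ∧
  (∀ y ∈ U, 0 < y (lastIdx d hd) → hodOp d hd v y = 0) ∧
  (∀ y ∈ U, y (lastIdx d hd) = 0 →
    gradC d v y (lastIdx d hd) = hodN d hd (fun m => gradC d v y m))

/-- `v` is a subsolution of the hodograph PDE on `U`. -/
def IsHodSubsol (d : ℕ) (hd : 0 < d) (v : EuclideanSpace ℝ (Fin d) → ℝ)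
    (U : Set (EuclideanSpace ℝ (Fin d))) : Prop :=
  SmoothNear d v U ∧
  (∀ y ∈ U, 0 < y (lastIdx d hd) → 0 ≤ hodOp d hd v y) ∧
  (∀ y ∈ U, y (lastIdx d hd) = 0 →
    hodN d hd (fun m => gradC d v y m) ≤ gradC d v y (lastIdx d hd))

/-- `v` is a supersolution of the hodograph PDE on `U`. -/
def IsHodSupersol (d : ℕ) (hd : 0 < d) (v : EuclideanSpace ℝ (Fin d) → ℝ)
    (U : Set (EuclideanSpace ℝ (Fin d))) : Prop :=
  SmoothNear d v U ∧
  (∀ y ∈ U, 0 < y (lastIdx d hd) → hodOp d hd v y ≤ 0) ∧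
  (∀ y ∈ U, y (lastIdx d hd) = 0 →
    gradC d v y (lastIdx d hd) ≤ hodN d hd (fun m => gradC d v y m))

/-- The exterior half-space domain `H₁ = {y : y_d ≥ 0, |y| ≥ 1}`. -/
def extDom (d : ℕ) (hd : 0 < d) : Set (EuclideanSpace ℝ (Fin d)) :=
  {y | 0 ≤ y (lastIdx d hd) ∧ 1 ≤ ‖y‖}

/-- The half annulus `A_r = {y : 1 ≤ |y| ≤ r, y_d ≥ 0}`. -/
def halfAnn (d : ℕ) (hd : 0 < d) (r : ℝ) : Set (EuclideanSpace ℝ (Fin d)) :=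
  {y | 0 ≤ y (lastIdx d hd) ∧ 1 ≤ ‖y‖ ∧ ‖y‖ ≤ r}

/-- The upper half sphere `∂B_ρ⁺ = {y : y_d ≥ 0, |y| = ρ}`. -/
def upSphere (d : ℕ) (hd : 0 < d) (ρ : ℝ) : Set (EuclideanSpace ℝ (Fin d)) :=
  {y | 0 ≤ y (lastIdx d hd) ∧ ‖y‖ = ρ}

/-- The filter of `|y| → ∞` within `H₁`. -/
def farFilter (d : ℕ) (hd : 0 < d) : Filter (EuclideanSpace ℝ (Fin d)) :=
  (Filter.comap (fun y : EuclideanSpace ℝ (Fin d) => ‖y‖) Filter.atTop) ⊓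
    Filter.principal (extDom d hd)

theorem exists_smooth_cutoff : ∃ (b b' : ℝ → ℝ) (M : ℝ), 0 ≤ M ∧ (∀ t, HasDerivAt b (b' t) t) ∧
    Continuous b' ∧ (∀ t, 0 ≤ b t) ∧ (∀ t, b t ≤ 1) ∧ (∀ t, |b' t| ≤ M) ∧
    (∀ t, |t| ≤ 1 → b t = 1 ∧ b' t = 0) ∧ (∀ t, 2 ≤ |t| → b t = 0) := by
  let b : ContDiffBump (0 : ℝ) := ⟨1, 2, by norm_num, by norm_num⟩
  have hb : ContDiff ℝ 1 b := b.contDiff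
  have hd : Continuous (deriv b) := hb.continuous_deriv le_rfl
  obtain ⟨M, hM⟩ := hd.bounded_above_of_compact_support b.hasCompactSupport.deriv
  have hone : ∀ t : ℝ, |t| ≤ 1 → b t = 1 := fun t ht =>
    b.one_of_mem_closedBall (by simpa [b] using ht)
  refine ⟨b, deriv b, M, (norm_nonneg _).trans (hM 0), fun t =>
    ((hb.differentiable one_ne_zero) t).hasDerivAt, hd, fun t => b.nonneg, fun t => b.le_one,
    fun t => hM t, fun t ht => ⟨hone t ht, ?_⟩, fun t ht => b.zero_of_le_dist ?_⟩
  · exact IsLocalMax.deriv_eq_zero (Eventually.of_forall fun s => (hone t ht).symm ▸ b.le_one)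
  · simpa [b] using ht

/-- The half square of side `2R` resting on the boundary of the upper half plane. -/
def halfBox (R : ℝ) : Set (ℝ × ℝ) := Icc (-R, 0) (R, R)

theorem mem_halfBox {R : ℝ} {z : ℝ × ℝ} : z ∈ halfBox R ↔ |z.1| ≤ R ∧ 0 ≤ z.2 ∧ z.2 ≤ R := by
  simp only [halfBox, mem_Icc, Prod.le_def, abs_le]
  tauto

theorem halfBox_subset_upper (R : ℝ) : halfBox R ⊆ {z | 0 ≤ z.2} := fun _ hz =>
  (mem_halfBox.1 hz).2.1

theorem halfBox_mono {r R : ℝ} (h : r ≤ R) : halfBox r ⊆ halfBox R := fun z hz => by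
  rw [mem_halfBox] at *
  exact ⟨hz.1.trans h, hz.2.1, hz.2.2.trans h⟩

theorem volume_real_halfBox {R : ℝ} (hR : 0 ≤ R) : volume.real (halfBox R) = 2 * R ^ 2 := by
  have : halfBox R = Icc (-R) R ×ˢ Icc 0 R := by
    rw [halfBox, ← Icc_prod_Icc]
  rw [this, Measure.volume_eq_prod, measureReal_prod_prod, Real.volume_real_Icc_of_le (by linarith),
    Real.volume_real_Icc_of_le hR]
  ring

/-- A vector field `(V₁, V₂)` on the closed upper half plane whose divergence `E` controls its
square, and which points into the half plane along the boundary. -/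
structure CoerciveField (V₁ V₂ E : ℝ × ℝ → ℝ) (C : ℝ) : Prop where
  cont₁ : ContinuousOn V₁ {z | 0 ≤ z.2}
  cont₂ : ContinuousOn V₂ {z | 0 ≤ z.2}
  cont : ContinuousOn E {z | 0 ≤ z.2}
  diff₁ : ∀ z : ℝ × ℝ, 0 < z.2 → DifferentiableAt ℝ V₁ z
  diff₂ : ∀ z : ℝ × ℝ, 0 < z.2 → DifferentiableAt ℝ V₂ z
  div_eq : ∀ z : ℝ × ℝ, 0 < z.2 → fderiv ℝ V₁ z (1, 0) + fderiv ℝ V₂ z (0, 1) = E z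
  nonneg : ∀ z : ℝ × ℝ, 0 ≤ z.2 → 0 ≤ E z
  sq_le : ∀ z : ℝ × ℝ, 0 ≤ z.2 → V₁ z ^ 2 + V₂ z ^ 2 ≤ C * E z
  flux : ∀ x : ℝ, 0 ≤ V₂ (x, 0)

namespace CoerciveField

variable {V₁ V₂ E : ℝ × ℝ → ℝ} {C : ℝ}

theorem integrableOn (h : CoerciveField V₁ V₂ E C) (R : ℝ) : IntegrableOn E (halfBox R) :=
  (h.cont.mono (halfBox_subset_upper R)).integrableOn_compact isCompact_Icc

/-- Testing the divergence identity with a compactly supported cutoff. -/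
theorem integral_cutoff_le (h : CoerciveField V₁ V₂ E C) {R : ℝ} (hR : 0 < R)
    {θ θ₁ θ₂ : ℝ × ℝ → ℝ} (hθ : ∀ z, HasFDerivAt θ
      (θ₁ z • ContinuousLinearMap.fst ℝ ℝ ℝ + θ₂ z • ContinuousLinearMap.snd ℝ ℝ ℝ) z)
    (hc₁ : Continuous θ₁) (hc₂ : Continuous θ₂) (hθ0 : ∀ z, 0 ≤ θ z)
    (hsupp : ∀ z : ℝ × ℝ, (R ≤ |z.1| ∨ R ≤ |z.2|) → θ z = 0) :
    ∫ z in halfBox R, θ z * E z ≤ ∫ z in halfBox R, -(θ₁ z * V₁ z + θ₂ z * V₂ z) := by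
  have hcθ : Continuous θ := continuous_iff_continuousAt.2 fun z => (hθ z).continuousAt
  have sub := halfBox_subset_upper R
  have hi1 : IntegrableOn (fun z => θ z * E z) (halfBox R) :=
    (hcθ.continuousOn.mul (h.cont.mono sub)).integrableOn_compact isCompact_Icc
  have hi2 : IntegrableOn (fun z => θ₁ z * V₁ z + θ₂ z * V₂ z) (halfBox R) :=
    ((hc₁.continuousOn.mul (h.cont₁.mono sub)).add
      (hc₂.continuousOn.mul (h.cont₂.mono sub))).integrableOn_compact isCompact_Icc
  have hint : IntegrableOn (fun z => θ z * E z + (θ₁ z * V₁ z + θ₂ z * V₂ z)) (halfBox R) :=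
    hi1.add hi2
  have hae : ∀ᵐ z ∂(volume.restrict (halfBox R)), 0 < z.2 := by
    rw [halfBox, ae_restrict_iff' measurableSet_Icc]
    have : ∀ᵐ z : ℝ × ℝ, z.2 ≠ 0 := by
      have := (MeasureTheory.Measure.quasiMeasurePreserving_snd (μ := (volume : Measure ℝ))
        (ν := (volume : Measure ℝ))).ae (Measure.ae_ne volume (0 : ℝ))
      exact this
    filter_upwards [this] with z hz hmem
    exact lt_of_le_of_ne hmem.1.2 (Ne.symm hz)
  let F₁ : ℝ × ℝ → ℝ × ℝ →L[ℝ] ℝ := fun z => θ z • fderiv ℝ V₁ z +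
    V₁ z • (θ₁ z • ContinuousLinearMap.fst ℝ ℝ ℝ + θ₂ z • ContinuousLinearMap.snd ℝ ℝ ℝ)
  let F₂ : ℝ × ℝ → ℝ × ℝ →L[ℝ] ℝ := fun z => θ z • fderiv ℝ V₂ z +
    V₂ z • (θ₁ z • ContinuousLinearMap.fst ℝ ℝ ℝ + θ₂ z • ContinuousLinearMap.snd ℝ ℝ ℝ)
  have hpt : ∀ z : ℝ × ℝ, 0 < z.2 → F₁ z (1, 0) + F₂ z (0, 1) =
      θ z * E z + (θ₁ z * V₁ z + θ₂ z * V₂ z) := fun z hz => by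
    rw [← h.div_eq z hz]
    simp [F₁, F₂]
    ring
  have haeq : (fun z => F₁ z (1, 0) + F₂ z (0, 1)) =ᵐ[volume.restrict (halfBox R)]
      fun z => θ z * E z + (θ₁ z * V₁ z + θ₂ z * V₂ z) := hae.mono hpt
  have key := integral_divergence_prod_Icc_of_hasFDerivAt_of_le (fun z => θ z * V₁ z)
    (fun z => θ z * V₂ z) F₁ F₂ (-R, 0) (R, R) ⟨by simp; linarith, by simpa using hR.le⟩
    (hcθ.continuousOn.mul (h.cont₁.mono sub)) (hcθ.continuousOn.mul (h.cont₂.mono sub))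
    (fun z hz => (hθ z).mul' (h.diff₁ z hz.2.1).hasFDerivAt |>.congr_fderiv (by simp [F₁]))
    (fun z hz => (hθ z).mul' (h.diff₂ z hz.2.1).hasFDerivAt |>.congr_fderiv (by simp [F₂]))
    (hint.congr haeq.symm)
  have e1 : ∀ x, θ (x, R) = 0 := fun x => hsupp _ (Or.inr (le_abs_self R))
  have e2 : ∀ y, θ (R, y) = 0 := fun x => hsupp _ (Or.inl (le_abs_self R))
  have e3 : ∀ y, θ (-R, y) = 0 := fun x => hsupp _ (Or.inl (by simp [le_abs_self R]))
  simp only [e1, e2, e3, zero_mul, intervalIntegral.integral_zero, add_zero, sub_zero,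
    zero_sub] at key
  have hflux : 0 ≤ ∫ x in (-R)..R, θ (x, 0) * V₂ (x, 0) :=
    intervalIntegral.integral_nonneg (by linarith) fun x _ => mul_nonneg (hθ0 _) (h.flux x)
  have key2 : ∫ z in halfBox R, (θ z * E z + (θ₁ z * V₁ z + θ₂ z * V₂ z)) ≤ 0 := by
    rw [← integral_congr_ae haeq]
    exact key.le.trans (by linarith)
  rw [integral_add hi1 hi2] at key2
  rw [integral_neg]
  linarith

theorem exists_energy_bound (h : CoerciveField V₁ V₂ E C) (hC : 0 < C) : ∃ K : ℝ, 0 ≤ K ∧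
    ∀ R : ℝ, 0 < R → (∫ z in halfBox R, E z ≤ K) ∧ ∀ t : ℝ, 0 < t → ∫ z in halfBox R, E z ≤
      t * ((∫ z in halfBox (2 * R), E z) - ∫ z in halfBox R, E z) + K / t := by
  obtain ⟨b, b', M, hM, hb, hcb', hb0, hb1, hbM, hin, hout⟩ := exists_smooth_cutoff
  have hcb : Continuous b := continuous_iff_continuousAt.2 fun t => (hb t).continuousAt
  refine ⟨32 * (2 * C * M ^ 2), by positivity, fun R hR => ?_⟩
  let θ : ℝ × ℝ → ℝ := fun z => b (z.1 / R) ^ 2 * b (z.2 / R) ^ 2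
  let θ₁ : ℝ × ℝ → ℝ := fun z => 2 * b (z.1 / R) * (b' (z.1 / R) / R) * b (z.2 / R) ^ 2
  let θ₂ : ℝ × ℝ → ℝ := fun z => b (z.1 / R) ^ 2 * (2 * b (z.2 / R) * (b' (z.2 / R) / R))
  have hdb : ∀ t : ℝ, HasDerivAt (fun t => b (t / R) ^ 2) (2 * b (t / R) * (b' (t / R) / R)) t :=
    fun t => by
      have h1 := ((hb (t / R)).comp t ((hasDerivAt_id t).div_const R)).pow 2
      refine h1.congr_deriv ?_
      simp only [Function.comp_apply, id_eq, Nat.cast_ofNat, Nat.add_one_sub_one, pow_one]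
      ring
  have hθ : ∀ z, HasFDerivAt θ
      (θ₁ z • ContinuousLinearMap.fst ℝ ℝ ℝ + θ₂ z • ContinuousLinearMap.snd ℝ ℝ ℝ) z := fun z => by
    have h1 := ((hdb z.1).comp_hasFDerivAt z (hasFDerivAt_fst (𝕜 := ℝ))).mul
      ((hdb z.2).comp_hasFDerivAt z (hasFDerivAt_snd (𝕜 := ℝ)))
    refine h1.congr_fderiv ?_
    ext
    · simp [θ₁, θ₂]
      ring
    · simp [θ₁, θ₂]
  have hcθ : Continuous θ := continuous_iff_continuousAt.2 fun z => (hθ z).continuousAt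
  have hc₁ : Continuous θ₁ := by fun_prop
  have hc₂ : Continuous θ₂ := by fun_prop
  have hθ0 : ∀ z, 0 ≤ θ z := fun z => by positivity
  have hθ1 : ∀ z, θ z ≤ 1 := fun z =>
    mul_le_one₀ (pow_le_one₀ (hb0 _) (hb1 _)) (by positivity) (pow_le_one₀ (hb0 _) (hb1 _))
  have hin' : ∀ z ∈ halfBox R, |z.1 / R| ≤ 1 ∧ |z.2 / R| ≤ 1 := fun z hz => by
    obtain ⟨h1, h2, h3⟩ := mem_halfBox.1 hz
    rw [abs_div, abs_div, abs_of_pos hR, div_le_one hR, div_le_one hR, abs_of_nonneg h2]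
    exact ⟨h1, h3⟩
  have hR2 : (0 : ℝ) < 2 * R := by linarith
  have sub := halfBox_subset_upper (2 * R)
  have hJ := h.integral_cutoff_le hR2 hθ hc₁ hc₂ hθ0 (by
    intro z hz
    have : ∀ s : ℝ, 2 * R ≤ |s| → b (s / R) = 0 := fun s hs => hout _ (by
      rw [abs_div, abs_of_pos hR, le_div_iff₀ hR]; exact hs)
    rcases hz with hz | hz <;> simp [θ, this _ hz])
  have hiθ : IntegrableOn (fun z => θ z * E z) (halfBox (2 * R)) :=
    (hcθ.continuousOn.mul (h.cont.mono sub)).integrableOn_compact isCompact_Icc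
  have hiV : IntegrableOn (fun z => -(θ₁ z * V₁ z + θ₂ z * V₂ z)) (halfBox (2 * R)) :=
    (((hc₁.continuousOn.mul (h.cont₁.mono sub)).add
      (hc₂.continuousOn.mul (h.cont₂.mono sub))).neg).integrableOn_compact isCompact_Icc
  have hsubset : halfBox R ⊆ halfBox (2 * R) := halfBox_mono (by linarith)
  have hmeas : ∀ r, MeasurableSet (halfBox r) := fun r => measurableSet_Icc
  have hIJ : ∫ z in halfBox R, E z ≤ ∫ z in halfBox (2 * R), θ z * E z := by
    calc ∫ z in halfBox R, E z = ∫ z in halfBox R, θ z * E z :=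
          setIntegral_congr_fun (hmeas R) fun z hz => by
            simp [θ, (hin _ (hin' z hz).1).1, (hin _ (hin' z hz).2).1]
      _ ≤ _ := setIntegral_mono_set hiθ
          ((ae_restrict_iff' (hmeas _)).2 (Eventually.of_forall fun z hz =>
            mul_nonneg (hθ0 z) (h.nonneg z (sub hz)))) hsubset.eventuallyLE
  have hyoung : ∀ t : ℝ, 0 < t → ∀ z ∈ halfBox (2 * R), -(θ₁ z * V₁ z + θ₂ z * V₂ z) ≤
      t * (θ z * E z) + 2 * C * M ^ 2 / (t * R ^ 2) := fun t ht z hz => by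
    have hsq := h.sq_le z (sub hz)
    have key : ∀ a c d V : ℝ, 0 ≤ a → a ≤ 1 → 0 ≤ c → c ≤ 1 → |d| ≤ M →
        -(2 * a * (d / R) * c ^ 2 * V) ≤
          t * (a ^ 2 * c ^ 2 * V ^ 2 / C) + C * M ^ 2 / (t * R ^ 2) := by
      intro a c d V ha ha1 hc hc1 hd
      have h1 : (c * d) ^ 2 ≤ M ^ 2 := by
        rw [mul_pow, ← sq_abs d]
        have := pow_le_pow_left₀ (abs_nonneg d) hd 2
        have := pow_le_one₀ hc hc1 (n := 2)
        nlinarith [sq_nonneg |d|, sq_nonneg c]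
      have h2 : C * (c * d) ^ 2 / (t * R ^ 2) ≤ C * M ^ 2 / (t * R ^ 2) := by gcongr
      have h3 : 0 ≤ (t * a * c * V + C * (c * d) / R) ^ 2 / (t * C) := by positivity
      have h4 : (t * a * c * V + C * (c * d) / R) ^ 2 / (t * C) =
          t * (a ^ 2 * c ^ 2 * V ^ 2 / C) + 2 * a * (d / R) * c ^ 2 * V +
            C * (c * d) ^ 2 / (t * R ^ 2) := by
        field_simp
        ring
      linarith
    have k1 := key _ _ _ (V₁ z) (hb0 (z.1 / R)) (hb1 (z.1 / R)) (hb0 (z.2 / R)) (hb1 (z.2 / R))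
      (hbM (z.1 / R))
    have k2 := key _ _ _ (V₂ z) (hb0 (z.2 / R)) (hb1 (z.2 / R)) (hb0 (z.1 / R)) (hb1 (z.1 / R))
      (hbM (z.2 / R))
    have h5 : t * (θ z * ((V₁ z ^ 2 + V₂ z ^ 2) / C)) ≤ t * (θ z * E z) := by
      have : (V₁ z ^ 2 + V₂ z ^ 2) / C ≤ E z := by rw [div_le_iff₀ hC]; linarith
      have := hθ0 z
      gcongr
    have h6 : t * (θ z * ((V₁ z ^ 2 + V₂ z ^ 2) / C)) =
        t * (b (z.1 / R) ^ 2 * b (z.2 / R) ^ 2 * V₁ z ^ 2 / C) +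
          t * (b (z.2 / R) ^ 2 * b (z.1 / R) ^ 2 * V₂ z ^ 2 / C) := by
      simp only [θ]; ring
    have h7 : 2 * C * M ^ 2 / (t * R ^ 2) =
        C * M ^ 2 / (t * R ^ 2) + C * M ^ 2 / (t * R ^ 2) := by ring
    have h8 : θ₁ z * V₁ z + θ₂ z * V₂ z =
        2 * b (z.1 / R) * (b' (z.1 / R) / R) * b (z.2 / R) ^ 2 * V₁ z +
          2 * b (z.2 / R) * (b' (z.2 / R) / R) * b (z.1 / R) ^ 2 * V₂ z := by
      simp only [θ₁, θ₂]; ring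
    rw [h7, h8]
    linarith
  have hconst : ∀ t : ℝ, 0 < t → ∫ _ in halfBox (2 * R), 2 * C * M ^ 2 / (t * R ^ 2) =
      8 * (2 * C * M ^ 2) / t := fun t ht => by
    rw [setIntegral_const, volume_real_halfBox hR2.le, smul_eq_mul]
    field_simp
    ring
  have hiC : ∀ c : ℝ, IntegrableOn (fun _ => c) (halfBox (2 * R)) := fun c =>
    continuousOn_const.integrableOn_compact isCompact_Icc
  constructor
  · have h1 : ∫ z in halfBox (2 * R), -(θ₁ z * V₁ z + θ₂ z * V₂ z) ≤
        ∫ z in halfBox (2 * R), (1 / 2 * (θ z * E z) + 2 * C * M ^ 2 / (1 / 2 * R ^ 2)) :=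
      setIntegral_mono_on hiV ((hiθ.const_mul _).add (hiC _)) (hmeas _)
        (hyoung _ (by norm_num))
    rw [integral_add (hiθ.const_mul _) (hiC _), integral_const_mul,
      hconst (1 / 2) (by norm_num)] at h1
    linarith
  · intro t ht
    have hdiff : MeasurableSet (halfBox (2 * R) \ halfBox R) := (hmeas _).diff (hmeas _)
    have hiind : IntegrableOn ((halfBox (2 * R) \ halfBox R).indicator E) (halfBox (2 * R)) :=
      (h.integrableOn (2 * R)).indicator hdiff
    have h1 : ∫ z in halfBox (2 * R), -(θ₁ z * V₁ z + θ₂ z * V₂ z) ≤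
        ∫ z in halfBox (2 * R), (t * (halfBox (2 * R) \ halfBox R).indicator E z +
          2 * C * M ^ 2 / (t * R ^ 2)) := by
      refine setIntegral_mono_on hiV ((hiind.const_mul _).add (hiC _)) (hmeas _) fun z hz => ?_
      by_cases hzR : z ∈ halfBox R
      · rw [indicator_of_notMem (fun hm => hm.2 hzR)]
        simp only [θ₁, θ₂, (hin _ (hin' z hzR).1).2, (hin _ (hin' z hzR).2).2]
        simp
        positivity
      · rw [indicator_of_mem (show z ∈ halfBox (2 * R) \ halfBox R from ⟨hz, hzR⟩)]
        refine (hyoung t ht z hz).trans ?_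
        have := mul_le_of_le_one_left (h.nonneg z (sub hz)) (hθ1 z)
        gcongr
    rw [integral_add (hiind.const_mul _) (hiC _), integral_const_mul, hconst t ht,
      setIntegral_indicator hdiff, inter_eq_right.2 sdiff_subset,
      setIntegral_sdiff (hmeas R) (h.integrableOn _) hsubset] at h1
    have : 8 * (2 * C * M ^ 2) / t ≤ 32 * (2 * C * M ^ 2) / t := by
      have : 0 ≤ 2 * C * M ^ 2 := by positivity
      gcongr
      linarith
    linarith

/-- A coercive field in the half plane is divergence free: the half plane is parabolic. -/
theorem eq_zero (h : CoerciveField V₁ V₂ E C) (hC : 0 < C) {z : ℝ × ℝ} (hz : 0 < z.2) :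
    E z = 0 := by
  obtain ⟨K, hK, hKR⟩ := h.exists_energy_bound hC
  let a : ℕ → ℝ := fun n => ∫ z in halfBox (2 ^ n), E z
  have hmono : Monotone a := fun m n hmn =>
    setIntegral_mono_set (h.integrableOn _) ((ae_restrict_iff' measurableSet_Icc).2
      (Eventually.of_forall fun z hz => h.nonneg z (halfBox_subset_upper _ hz)))
      (halfBox_mono (pow_le_pow_right₀ one_le_two hmn)).eventuallyLE
  have hpos : ∀ n, 0 ≤ a n := fun n => setIntegral_nonneg measurableSet_Icc fun z hz =>
    h.nonneg z (halfBox_subset_upper _ hz)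
  have hlim := tendsto_atTop_ciSup hmono
    ⟨K, by rintro _ ⟨n, rfl⟩; exact (hKR _ (by positivity)).1⟩
  have hlim' := (tendsto_add_atTop_iff_nat 1).2 hlim
  have hle : ∀ t : ℝ, 0 < t → (⨆ n, a n) ≤ K / t := fun t ht => by
    have h1 := ((hlim'.sub hlim).const_mul t).add_const (K / t)
    rw [sub_self, mul_zero, zero_add] at h1
    refine le_of_tendsto_of_tendsto' hlim h1 fun n => ?_
    have := (hKR (2 ^ n) (by positivity)).2 t ht
    rwa [← pow_succ'] at this
  have hsup : (⨆ n, a n) ≤ 0 :=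
    le_of_tendsto_of_tendsto tendsto_const_nhds (tendsto_const_nhds.div_atTop tendsto_id)
      ((eventually_gt_atTop 0).mono hle)
  have ha : ∀ n, a n = 0 := fun n => le_antisymm ((hmono.ge_of_tendsto hlim n).trans hsup) (hpos n)
  obtain ⟨n, hn⟩ := pow_unbounded_of_one_lt (max |z.1| |z.2|) (one_lt_two (α := ℝ))
  have hae : E =ᵐ[volume.restrict (halfBox (2 ^ n))] 0 :=
    (setIntegral_eq_zero_iff_of_nonneg_ae ((ae_restrict_iff' measurableSet_Icc).2
      (Eventually.of_forall fun z hz => h.nonneg z (halfBox_subset_upper _ hz)))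
      (h.integrableOn _)).1 (ha n)
  let U : Set (ℝ × ℝ) := Ioo (-2 ^ n) (2 ^ n) ×ˢ Ioo 0 (2 ^ n)
  have hU : U ⊆ halfBox (2 ^ n) := fun w hw =>
    mem_halfBox.2 ⟨abs_le.2 ⟨hw.1.1.le, hw.1.2.le⟩, hw.2.1.le, hw.2.2.le⟩
  refine Measure.eqOn_open_of_ae_eq (U := U) (ae_restrict_of_ae_restrict_of_subset hU hae)
    (isOpen_Ioo.prod isOpen_Ioo) (h.cont.mono fun w hw => hw.2.1.le) continuousOn_const ?_
  obtain ⟨h1, h2⟩ := max_lt_iff.1 hn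
  exact ⟨abs_lt.1 h1, hz, (le_abs_self _).trans_lt h2⟩

end CoerciveField
theorem summable_coeff_mul_pow {b : ℕ → ℝ} {B : ℝ} {k : ℕ} (hb : ∀ n, |b n| ≤ B * (n + 1) ^ k)
    {r : ℝ} (hr : |r| < 1) : Summable fun n => b n * r ^ n := by
  have h0 : Summable fun n : ℕ => (n + 1 : ℝ) ^ k * |r| ^ n := by
    rcases eq_or_ne r 0 with rfl | hr0
    · refine summable_of_ne_finset_zero (s := {0}) fun n hn => ?_
      simp [Finset.mem_singleton.not.1 hn]
    · have h1 := (summable_nat_add_iff 1).2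
        (summable_pow_mul_geometric_of_norm_lt_one k (r := |r|) (by simpa using hr))
      refine (h1.mul_right |r|⁻¹).congr fun n => ?_
      have : |r| ≠ 0 := abs_ne_zero.2 hr0
      push_cast
      rw [pow_succ]
      field_simp
  refine Summable.of_norm_bounded (h0.mul_left B) fun n => ?_
  rw [norm_mul, norm_pow, Real.norm_eq_abs, Real.norm_eq_abs, ← mul_assoc]
  exact mul_le_mul_of_nonneg_right (hb n) (by positivity)

theorem abs_shifted_coeff_le {b : ℕ → ℝ} {B : ℝ} {k : ℕ} (hb : ∀ n, |b n| ≤ B * (n + 1) ^ k)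
    (n : ℕ) : |(n + 1) * b (n + 1)| ≤ B * 2 ^ k * (n + 1) ^ (k + 1) := by
  have hB : 0 ≤ B := by simpa using (abs_nonneg _).trans (hb 0)
  have h1 := hb (n + 1)
  push_cast at h1
  have h2 : ((n : ℝ) + 1 + 1) ^ k ≤ (2 * (n + 1)) ^ k :=
    pow_le_pow_left₀ (by positivity) (by linarith [n.cast_nonneg (α := ℝ)]) k
  rw [abs_mul, abs_of_nonneg (by positivity : (0 : ℝ) ≤ n + 1)]
  calc ((n : ℝ) + 1) * |b (n + 1)| ≤ (n + 1) * (B * (2 * (n + 1)) ^ k) := by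
        gcongr
        exact h1.trans (by gcongr)
    _ = B * 2 ^ k * (n + 1) ^ (k + 1) := by rw [mul_pow]; ring

theorem hasDerivAt_tsum_coeff_mul_pow {b : ℕ → ℝ} {B : ℝ} {k : ℕ}
    (hb : ∀ n, |b n| ≤ B * (n + 1) ^ k) {x : ℝ} (hx : |x| < 1) :
    HasDerivAt (fun x => ∑' n, b n * x ^ n) (∑' n : ℕ, (n + 1) * b (n + 1) * x ^ n) x := by
  obtain ⟨r, hxr, hr1⟩ := exists_between hx
  have hr0 : 0 ≤ r := (abs_nonneg x).trans hxr.le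
  have hu : Summable fun n : ℕ => |b n * (n * r ^ (n - 1))| := by
    refine (summable_nat_add_iff 1).1 ?_
    refine ((summable_coeff_mul_pow (abs_shifted_coeff_le hb)
      (abs_lt.2 ⟨by linarith, hr1⟩)).abs).congr fun n => ?_
    push_cast
    congr 1
    ring
  have hmem : ∀ y : ℝ, y ∈ Metric.ball (0 : ℝ) r ↔ |y| < r := fun y => by simp
  have key := hasDerivAt_tsum_of_isPreconnected (g := fun n x => b n * x ^ n)
    (g' := fun n x => b n * (n * x ^ (n - 1))) hu Metric.isOpen_ball
    (convex_ball (0 : ℝ) r).isPreconnected (fun n y _ => (hasDerivAt_pow n y).const_mul (b n))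
    (fun n y hy => by
      rw [norm_mul, norm_mul, norm_pow, abs_mul, abs_mul, abs_pow, abs_of_nonneg hr0]
      simp only [Real.norm_eq_abs]
      have := ((hmem y).1 hy).le
      gcongr) ((hmem x).2 hxr) (summable_coeff_mul_pow hb hx) ((hmem x).2 hxr)
  refine key.congr_deriv ?_
  have hs : Summable fun n : ℕ => b n * (n * x ^ (n - 1)) := by
    refine (summable_nat_add_iff 1).1 ((summable_coeff_mul_pow (abs_shifted_coeff_le hb) hx).congr
      fun n => ?_)
    push_cast
    ring
  rw [hs.tsum_eq_zero_add]
  simp only [CharP.cast_eq_zero, zero_mul, mul_zero, zero_add, Nat.add_sub_cancel]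
  refine tsum_congr fun n => ?_
  push_cast
  ring

/-- Taylor coefficients of the even solution of `(1 + x²) X'' + 4 X = 0` with `X 0 = 1`. -/
def evenCoeff : ℕ → ℝ
  | 0 => 1
  | 1 => 0
  | n + 2 => -((n * (n - 1) + 4) / ((n + 2) * (n + 1))) * evenCoeff n

theorem abs_evenCoeff_add_two_le {n : ℕ} (hn : 1 ≤ n) :
    |evenCoeff (n + 2)| ≤ |evenCoeff n| := by
  have hn' : (1 : ℝ) ≤ n := by exact_mod_cast hn
  rw [evenCoeff, abs_mul, abs_neg]
  refine mul_le_of_le_one_left (abs_nonneg _) ?_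
  rw [abs_of_nonneg (div_nonneg (by nlinarith) (by positivity)), div_le_one (by positivity)]
  nlinarith

theorem evenCoeff_values : evenCoeff 0 = 1 ∧ evenCoeff 1 = 0 ∧ evenCoeff 2 = -2 ∧
    evenCoeff 3 = 0 ∧ evenCoeff 4 = 1 ∧ evenCoeff 5 = 0 := by
  simp only [evenCoeff]
  norm_num

theorem abs_evenCoeff_le_one (n : ℕ) : |evenCoeff (n + 3)| ≤ 1 := by
  obtain ⟨h0, h1, h2, h3, h4, h5⟩ := evenCoeff_values
  induction n using Nat.strong_induction_on with
  | _ n ih =>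
    match n with
    | 0 => simp [h3]
    | 1 => simp [h4]
    | n + 2 => exact (abs_evenCoeff_add_two_le (n := n + 3) (by omega)).trans (ih n (by omega))

theorem abs_evenCoeff_le (n : ℕ) : |evenCoeff n| ≤ 2 * (n + 1) ^ 0 := by
  obtain ⟨h0, h1, h2, h3, h4, h5⟩ := evenCoeff_values
  match n with
  | 0 => simp [h0]
  | 1 => simp [h1]
  | 2 => simp [h2]
  | n + 3 => simpa using (abs_evenCoeff_le_one n).trans one_le_two

theorem exists_even_solution : ∃ X X' : ℝ → ℝ, X 0 = 1 ∧ X' 0 = 0 ∧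
    (∀ x, |x| < 1 → HasDerivAt X (X' x) x) ∧
    (∀ x, |x| < 1 → HasDerivAt X' (-4 * X x / (1 + x ^ 2)) x) ∧
    (∀ x, |x| ≤ 1 / 2 → 0 < X x ∧ (1 + x ^ 2) ^ 2 * X x ≤ 1) := by
  obtain ⟨h0, h1, h2, h3, h4, h5⟩ := evenCoeff_values
  have hb := abs_evenCoeff_le
  have hb' := abs_shifted_coeff_le hb
  refine ⟨fun x => ∑' n, evenCoeff n * x ^ n,
    fun x => ∑' n : ℕ, (n + 1) * evenCoeff (n + 1) * x ^ n, ?_, ?_, fun x hx =>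
    hasDerivAt_tsum_coeff_mul_pow hb hx, fun x hx => ?_, fun x hx => ?_⟩
  · beta_reduce
    rw [tsum_eq_single 0 (fun n hn => by simp [hn])]
    simp [h0]
  · beta_reduce
    rw [tsum_eq_single 0 (fun n hn => by simp [hn])]
    simp [h1]
  · refine (hasDerivAt_tsum_coeff_mul_pow (b := fun n : ℕ => (n + 1) * evenCoeff (n + 1))
      hb' hx).congr_deriv ?_
    have hrec : ∀ n : ℕ, ((n : ℝ) + 1) * (((n + 1 : ℕ) + 1 : ℝ) * evenCoeff (n + 1 + 1)) =
        -(n * (n - 1) * evenCoeff n) - 4 * evenCoeff n := fun n => by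
      rw [evenCoeff]
      push_cast
      field_simp
      ring
    have hS := summable_coeff_mul_pow hb hx
    have hS2 : Summable fun n : ℕ =>
        ((n : ℝ) + 1) * (((n + 1 : ℕ) + 1 : ℝ) * evenCoeff (n + 1 + 1)) * x ^ n :=
      summable_coeff_mul_pow (abs_shifted_coeff_le
        (b := fun n : ℕ => (n + 1) * evenCoeff (n + 1)) hb') hx
    have hS3 : Summable fun n : ℕ => (n : ℝ) * (n - 1) * evenCoeff n * x ^ n := by
      refine ((hS2.add (hS.mul_left 4)).neg).congr fun n => ?_
      rw [hrec]
      ring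
    have e1 : ∑' n : ℕ, (n : ℝ) * (n - 1) * evenCoeff n * x ^ n =
        x ^ 2 * ∑' n : ℕ, ((n : ℝ) + 1) * (((n + 1 : ℕ) + 1 : ℝ) * evenCoeff (n + 1 + 1)) *
          x ^ n := by
      rw [← hS3.sum_add_tsum_nat_add 2, ← tsum_mul_left]
      simp only [Finset.sum_range_succ, Finset.sum_range_zero]
      norm_num
      refine tsum_congr fun n => ?_
      ring
    have e2 : ∑' n : ℕ, ((n : ℝ) + 1) * (((n + 1 : ℕ) + 1 : ℝ) * evenCoeff (n + 1 + 1)) * x ^ n =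
        -(∑' n : ℕ, (n : ℝ) * (n - 1) * evenCoeff n * x ^ n) -
          4 * ∑' n, evenCoeff n * x ^ n := by
      rw [← tsum_mul_left, ← tsum_neg, ← hS3.neg.tsum_sub (hS.mul_left 4)]
      refine tsum_congr fun n => ?_
      rw [hrec]
      ring
    rw [eq_div_iff (by positivity)]
    rw [e1] at e2
    linarith
  · have hx1 : |x| < 1 := by linarith
    have hS := summable_coeff_mul_pow hb hx1
    have e := hS.sum_add_tsum_nat_add 6
    simp only [Finset.sum_range_succ, Finset.sum_range_zero, h0, h1, h2, h3, h4, h5] at e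
    have hG : HasSum (fun n : ℕ => |x| ^ 6 * |x| ^ n) (|x| ^ 6 * (1 - |x|)⁻¹) :=
      (hasSum_geometric_of_lt_one (abs_nonneg x) hx1).mul_left _
    have ht : ‖∑' n : ℕ, evenCoeff (n + 6) * x ^ (n + 6)‖ ≤ |x| ^ 6 * (1 - |x|)⁻¹ :=
      tsum_of_norm_bounded hG fun n => by
        rw [norm_mul, norm_pow, Real.norm_eq_abs, Real.norm_eq_abs, pow_add, mul_comm (|x| ^ n)]
        exact mul_le_of_le_one_left (by positivity) (abs_evenCoeff_le_one (n + 3))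
    have hinv : (1 - |x|)⁻¹ ≤ 2 := by
      rw [inv_le_comm₀ (by linarith) two_pos]
      linarith
    have hx2 : x ^ 2 ≤ 1 / 4 := by
      rw [← sq_abs]
      nlinarith [abs_nonneg x]
    have h6 : |x| ^ 6 = x ^ 6 := by
      rw [show 6 = 2 * 3 by rfl, pow_mul, sq_abs, pow_mul]
    rw [h6, Real.norm_eq_abs] at ht
    have ht2 : |∑' n : ℕ, evenCoeff (n + 6) * x ^ (n + 6)| ≤ x ^ 4 / 2 := by
      refine ht.trans ((mul_le_mul_of_nonneg_left hinv (by positivity)).trans ?_)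
      nlinarith [sq_nonneg (x ^ 2)]
    obtain ⟨l, u⟩ := abs_le.1 ht2
    have hs0 := sq_nonneg x
    have key : ∀ T : ℝ, -(x ^ 4 / 2) ≤ T → T ≤ x ^ 4 / 2 →
        0 < 1 - 2 * x ^ 2 + x ^ 4 + T ∧ (1 + x ^ 2) ^ 2 * (1 - 2 * x ^ 2 + x ^ 4 + T) ≤ 1 := by
      intro T hl hu
      constructor
      · nlinarith
      · have : (1 + x ^ 2) ^ 2 * (1 - 2 * x ^ 2 + x ^ 4 + T) ≤
            (1 + x ^ 2) ^ 2 * (1 - 2 * x ^ 2 + x ^ 4 + x ^ 4 / 2) := by gcongr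
        refine this.trans ?_
        obtain ⟨s, hs⟩ : ∃ s, s = x ^ 2 := ⟨_, rfl⟩
        rw [show x ^ 4 = (x ^ 2) ^ 2 by ring, ← hs]
        rw [← hs] at hx2 hs0
        have : (1 + s) ^ 2 * (1 - 2 * s + s ^ 2 + s ^ 2 / 2) =
            1 - s ^ 2 * (3 / 2 - s - 3 / 2 * s ^ 2) := by ring
        rw [this]
        have : 0 ≤ 3 / 2 - s - 3 / 2 * s ^ 2 := by nlinarith
        nlinarith [mul_nonneg (sq_nonneg s) this]
    beta_reduce
    rw [show ∑' n, evenCoeff n * x ^ n = 1 - 2 * x ^ 2 + x ^ 4 +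
      ∑' n : ℕ, evenCoeff (n + 6) * x ^ (n + 6) by rw [← e]; ring]
    exact key _ l u
/-- The gradients on which the hodograph coefficients and the conservation laws are smooth. -/
def lawDom : Set (ℝ × ℝ) := {z | |z.1| < 1 ∧ -1 < z.2}

/-- The gradients of euclidean length at most `1/2`. -/
def gradDisc : Set (ℝ × ℝ) := {z | z.1 ^ 2 + z.2 ^ 2 ≤ 1 / 4}

theorem abs_le_of_mem_gradDisc {z : ℝ × ℝ} (hz : z ∈ gradDisc) : |z.1| ≤ 1 / 2 ∧ |z.2| ≤ 1 / 2 := by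
  have hz' : z.1 ^ 2 + z.2 ^ 2 ≤ 1 / 4 := hz
  exact ⟨abs_le_of_sq_le_sq (by nlinarith [sq_nonneg z.2]) (by norm_num),
    abs_le_of_sq_le_sq (by nlinarith [sq_nonneg z.1]) (by norm_num)⟩

theorem gradDisc_subset_lawDom : gradDisc ⊆ lawDom := fun z hz => by
  obtain ⟨h1, h2⟩ := abs_le_of_mem_gradDisc hz
  exact ⟨by linarith, by linarith [(abs_le.1 h2).1]⟩

theorem isCompact_gradDisc : IsCompact gradDisc := by
  refine Metric.isCompact_of_isClosed_isBounded ?_ ?_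
  · exact isClosed_le (by fun_prop) continuous_const
  · refine (Metric.isBounded_closedBall (x := (0 : ℝ × ℝ)) (r := 1 / 2)).subset fun z hz => ?_
    obtain ⟨h1, h2⟩ := abs_le_of_mem_gradDisc hz
    rw [mem_closedBall_zero_iff, Prod.norm_def]
    exact max_le h1 h2

theorem convex_gradDisc : Convex ℝ gradDisc := by
  intro z hz w hw a b ha hb hab
  simp only [gradDisc, Set.mem_ofPred_eq, Prod.fst_add, Prod.snd_add, Prod.smul_fst, Prod.smul_snd,
    smul_eq_mul] at *
  have h1 : (a * z.1 + b * w.1) ^ 2 + (a * z.2 + b * w.2) ^ 2 =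
      a * (z.1 ^ 2 + z.2 ^ 2) + b * (w.1 ^ 2 + w.2 ^ 2) -
        a * b * ((z.1 - w.1) ^ 2 + (z.2 - w.2) ^ 2) := by
    obtain rfl : b = 1 - a := by linarith
    ring
  have h2 : 0 ≤ a * b * ((z.1 - w.1) ^ 2 + (z.2 - w.2) ^ 2) := by positivity
  nlinarith [mul_le_mul_of_nonneg_left hz ha, mul_le_mul_of_nonneg_left hw hb]

/-- A conservation law of the planar hodograph PDE: `f(∇v)_x + g(∇v)_y` is the multiple `lam(∇v)`
of the hodograph operator. -/
structure GradLaw (f g lam kap : ℝ × ℝ → ℝ) : Prop where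
  hasFDerivAt_f : ∀ z ∈ lawDom, HasFDerivAt f
    (lam z • ContinuousLinearMap.fst ℝ ℝ ℝ + kap z • ContinuousLinearMap.snd ℝ ℝ ℝ) z
  hasFDerivAt_g : ∀ z ∈ lawDom, HasFDerivAt g
    ((2 * z.1 / (1 + z.2) * lam z - kap z) • ContinuousLinearMap.fst ℝ ℝ ℝ +
      ((1 + z.1 ^ 2) / (1 + z.2) ^ 2 * lam z) • ContinuousLinearMap.snd ℝ ℝ ℝ) z
  cont_lam : ContinuousOn lam lawDom
  cont_kap : ContinuousOn kap lawDom
  lam_pos : ∀ z ∈ gradDisc, 0 < lam z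
  f_zero : f 0 = 0
  g_zero : g 0 = 0

theorem ellipticity_gradDisc {p q t : ℝ} (hz : p ^ 2 + q ^ 2 ≤ 1 / 4) (ht : |t| ≤ 1) :
    (p ^ 2 + q ^ 2) / 8 ≤
      p ^ 2 + 2 * (t * p) / (1 + t * q) * p * q + (1 + (t * p) ^ 2) / (1 + t * q) ^ 2 * q ^ 2 := by
  obtain ⟨hp, hq⟩ := abs_le_of_mem_gradDisc (z := (p, q)) hz
  have htq : |t * q| ≤ 1 / 2 := by
    rw [abs_mul]
    nlinarith [abs_nonneg t, abs_nonneg q]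
  have htp : |t * p| ≤ 1 / 2 := by
    rw [abs_mul]
    nlinarith [abs_nonneg t, abs_nonneg p]
  obtain ⟨h1, h2⟩ := abs_le.1 htq
  have hQ : 0 < 1 + t * q := by linarith
  obtain ⟨a, ha⟩ : ∃ a, a = t * p / (1 + t * q) := ⟨_, rfl⟩
  obtain ⟨k, hk⟩ : ∃ k, k = 1 / (1 + t * q) := ⟨_, rfl⟩
  have e : p ^ 2 + 2 * (t * p) / (1 + t * q) * p * q +
      (1 + (t * p) ^ 2) / (1 + t * q) ^ 2 * q ^ 2 = (p + a * q) ^ 2 + (k * q) ^ 2 := by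
    rw [ha, hk]
    field_simp
    ring
  have hk2 : 2 / 3 ≤ k := by
    rw [hk, le_div_iff₀ hQ]
    linarith
  have ha1 : |a| ≤ 1 := by
    rw [ha, abs_div, abs_of_pos hQ, div_le_one hQ]
    linarith
  have ha2 : a ^ 2 ≤ 1 := (sq_le_one_iff_abs_le_one a).2 ha1
  have hkq : 4 / 9 * q ^ 2 ≤ (k * q) ^ 2 := by
    rw [mul_pow]
    have : (4 : ℝ) / 9 ≤ k ^ 2 := by nlinarith
    gcongr
  have haq : (a * q) ^ 2 ≤ q ^ 2 := by
    rw [mul_pow]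
    nlinarith [sq_nonneg q]
  rw [e]
  nlinarith [sq_nonneg (p + 2 * (a * q)), sq_nonneg (p + a * q)]

namespace GradLaw

variable {f g lam kap : ℝ × ℝ → ℝ}

theorem exists_lower_bound (h : GradLaw f g lam kap) : ∃ c : ℝ, 0 < c ∧ ∀ z ∈ gradDisc,
    c * (z.1 ^ 2 + z.2 ^ 2) ≤ z.1 * f z + z.2 * g z := by
  have h0 : (0 : ℝ × ℝ) ∈ gradDisc := by simp [gradDisc]
  obtain ⟨w, hw, hmin⟩ := isCompact_gradDisc.exists_isMinOn ⟨0, h0⟩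
    (h.cont_lam.mono gradDisc_subset_lawDom)
  refine ⟨lam w / 8, by linarith [h.lam_pos w hw], fun z hz => ?_⟩
  have hmem : ∀ t ∈ Icc (0 : ℝ) 1, t • z ∈ gradDisc := fun t ht =>
    convex_gradDisc.smul_mem_of_zero_mem h0 hz ht
  have hder : ∀ t ∈ Icc (0 : ℝ) 1, HasDerivAt (fun t : ℝ => z.1 * f (t • z) + z.2 * g (t • z))
      (lam (t • z) * (z.1 ^ 2 + 2 * (t * z.1) / (1 + t * z.2) * z.1 * z.2 +
        (1 + (t * z.1) ^ 2) / (1 + t * z.2) ^ 2 * z.2 ^ 2)) t := fun t ht => by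
    have hl : HasDerivAt (fun t : ℝ => t • z) z t := by
      simpa using (hasDerivAt_id t).smul_const z
    have hN := gradDisc_subset_lawDom (hmem t ht)
    have h1 := ((h.hasFDerivAt_f _ hN).comp_hasDerivAt t hl).const_mul z.1
    have h2 := ((h.hasFDerivAt_g _ hN).comp_hasDerivAt t hl).const_mul z.2
    refine (h1.add h2).congr_deriv ?_
    simp
    ring
  obtain ⟨t, ht, hslope⟩ := exists_hasDerivAt_eq_slope _ _ zero_lt_one
    (fun t ht => (hder t ht).continuousAt.continuousWithinAt)
    (fun t ht => hder t (Ioo_subset_Icc_self ht))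
  have ht' := Ioo_subset_Icc_self ht
  have hell := ellipticity_gradDisc (t := t) hz (abs_le.2 ⟨by linarith [ht.1], ht.2.le⟩)
  have hlam : lam w ≤ lam (t • z) := hmin (hmem t ht')
  simp only [one_smul, zero_smul, h.f_zero, h.g_zero, mul_zero, add_zero, sub_zero,
    div_one] at hslope
  rw [← hslope]
  have hwpos := h.lam_pos w hw
  have hz0 : 0 ≤ (z.1 ^ 2 + z.2 ^ 2) / 8 := by positivity
  calc lam w / 8 * (z.1 ^ 2 + z.2 ^ 2) = lam w * ((z.1 ^ 2 + z.2 ^ 2) / 8) := by ring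
    _ ≤ _ := mul_le_mul hlam hell hz0 (hwpos.le.trans hlam)

theorem exists_upper_bound (h : GradLaw f g lam kap) : ∃ L : ℝ, 0 ≤ L ∧ ∀ z ∈ gradDisc,
    f z ^ 2 + g z ^ 2 ≤ L * (z.1 ^ 2 + z.2 ^ 2) := by
  have h0 : (0 : ℝ × ℝ) ∈ gradDisc := by simp [gradDisc]
  have hlip : ∀ (F a b : ℝ × ℝ → ℝ), F 0 = 0 → ContinuousOn a lawDom → ContinuousOn b lawDom →
      (∀ z ∈ lawDom, HasFDerivAt F
        (a z • ContinuousLinearMap.fst ℝ ℝ ℝ + b z • ContinuousLinearMap.snd ℝ ℝ ℝ) z) →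
      ∃ B : ℝ, 0 ≤ B ∧ ∀ z ∈ gradDisc, F z ^ 2 ≤ B * (z.1 ^ 2 + z.2 ^ 2) := by
    intro F a b hF ha hb hd
    obtain ⟨B, hB⟩ := isCompact_gradDisc.exists_bound_of_continuousOn
      (f := fun z => a z • ContinuousLinearMap.fst ℝ ℝ ℝ + b z • ContinuousLinearMap.snd ℝ ℝ ℝ)
      (((ha.smul continuousOn_const).add (hb.smul continuousOn_const)).mono
        gradDisc_subset_lawDom)
    refine ⟨B ^ 2, sq_nonneg B, fun z hz => ?_⟩
    have h1 := convex_gradDisc.norm_image_sub_le_of_norm_hasFDerivWithin_le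
      (fun w hw => (hd w (gradDisc_subset_lawDom hw)).hasFDerivWithinAt) hB h0 hz
    rw [hF, sub_zero, sub_zero, Real.norm_eq_abs] at h1
    have h2 : ‖z‖ ^ 2 ≤ z.1 ^ 2 + z.2 ^ 2 := by
      rw [Prod.norm_def]
      rcases max_choice ‖z.1‖ ‖z.2‖ with hm | hm <;> rw [hm, Real.norm_eq_abs, sq_abs] <;>
        nlinarith [sq_nonneg z.1, sq_nonneg z.2]
    calc F z ^ 2 = |F z| ^ 2 := (sq_abs _).symm
      _ ≤ (B * ‖z‖) ^ 2 := pow_le_pow_left₀ (abs_nonneg _) h1 2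
      _ = B ^ 2 * ‖z‖ ^ 2 := mul_pow _ _ _
      _ ≤ _ := by gcongr
  have hQ : ∀ z ∈ lawDom, (1 : ℝ) + z.2 ≠ 0 := fun z hz => by linarith [hz.2]
  obtain ⟨B, hB0, hB⟩ := hlip f lam kap h.f_zero h.cont_lam h.cont_kap h.hasFDerivAt_f
  obtain ⟨B', hB0', hB'⟩ := hlip g _ _ h.g_zero
    ((ContinuousOn.div (by fun_prop) (by fun_prop) hQ |>.mul h.cont_lam).sub h.cont_kap)
    (ContinuousOn.div (by fun_prop) (by fun_prop) (fun z hz => pow_ne_zero 2 (hQ z hz)) |>.mul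
      h.cont_lam) h.hasFDerivAt_g
  exact ⟨B + B', by linarith, fun z hz => by linarith [hB z hz, hB' z hz]⟩

theorem exists_coercivity (h : GradLaw f g lam kap) : ∃ C : ℝ, 0 < C ∧ ∀ z ∈ gradDisc,
    f z ^ 2 + g z ^ 2 ≤ C * (z.1 * f z + z.2 * g z) ∧
      z.1 ^ 2 + z.2 ^ 2 ≤ C * (z.1 * f z + z.2 * g z) := by
  obtain ⟨c, hc, hlow⟩ := h.exists_lower_bound
  obtain ⟨L, hL, hup⟩ := h.exists_upper_bound
  refine ⟨(L + 1) / c, by positivity, fun z hz => ?_⟩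
  have h0 : 0 ≤ z.1 ^ 2 + z.2 ^ 2 := by positivity
  have h1 : (L + 1) * (z.1 ^ 2 + z.2 ^ 2) ≤ (L + 1) / c * (z.1 * f z + z.2 * g z) := by
    rw [div_mul_eq_mul_div, le_div_iff₀ hc, mul_assoc, mul_comm _ c]
    exact mul_le_mul_of_nonneg_left (hlow z hz) (by linarith)
  have h2 := mul_nonneg hL h0
  constructor <;> linarith [hup z hz]

end GradLaw

/-- A conservation law whose boundary flux is nonnegative under the free boundary condition. -/
theorem exists_gradLaw_nonneg_flux : ∃ f g lam kap : ℝ × ℝ → ℝ, GradLaw f g lam kap ∧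
    ∀ z ∈ gradDisc, z.2 = √(1 + z.1 ^ 2) - 1 → 0 ≤ g z := by
  refine ⟨fun z => (z.1 / (1 + z.1 ^ 2) + Real.arctan z.1) / 2,
    fun z => 1 - 1 / ((1 + z.2) * (1 + z.1 ^ 2)), fun z => 1 / (1 + z.1 ^ 2) ^ 2, fun _ => 0,
    ⟨fun z hz => ?_, fun z hz => ?_, ?_, continuousOn_const, fun z hz => by positivity, by simp,
      by simp⟩, fun z hz hzb => ?_⟩
  · have h0 : 1 + z.1 ^ 2 ≠ 0 := by positivity
    have h1 : HasDerivAt (fun x : ℝ => (x / (1 + x ^ 2) + Real.arctan x) / 2)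
        (1 / (1 + z.1 ^ 2) ^ 2) z.1 := by
      refine ((((hasDerivAt_id z.1).div ((hasDerivAt_pow 2 z.1).const_add 1) h0).add
        (Real.hasDerivAt_arctan z.1)).div_const 2).congr_deriv ?_
      simp
      field_simp
      ring
    refine (h1.comp_hasFDerivAt z (hasFDerivAt_fst (𝕜 := ℝ))).congr_fderiv ?_
    simp
  · have hQ : (1 : ℝ) + z.2 ≠ 0 := by linarith [hz.2]
    have h0 : 1 + z.1 ^ 2 ≠ 0 := by positivity
    have h1 := (((hasFDerivAt_snd (𝕜 := ℝ) (p := z)).const_add 1).mul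
      ((((hasDerivAt_pow 2 z.1).const_add 1).comp_hasFDerivAt z (hasFDerivAt_fst (𝕜 := ℝ)))))
    have h2 := ((hasDerivAt_inv (mul_ne_zero hQ h0)).comp_hasFDerivAt z h1).const_sub 1
    simp only [one_div]
    refine h2.congr_fderiv ?_
    ext
    · simp
      field_simp
    · simp
      field_simp
  · exact ContinuousOn.div (by fun_prop) (by fun_prop) fun z _ => by positivity
  · have h1 : 1 ≤ √(1 + z.1 ^ 2) := Real.one_le_sqrt.2 (by nlinarith [sq_nonneg z.1])
    have h2 : 1 ≤ (1 + z.2) * (1 + z.1 ^ 2) := by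
      nlinarith [sq_nonneg z.1]
    rw [sub_nonneg]
    exact div_le_one_of_le₀ h2 (by linarith)

/-- A conservation law whose boundary flux is nonpositive under the free boundary condition. -/
theorem exists_gradLaw_nonpos_flux : ∃ f g lam kap : ℝ × ℝ → ℝ, GradLaw f g lam kap ∧
    ∀ z ∈ gradDisc, z.2 = √(1 + z.1 ^ 2) - 1 → g z ≤ 0 := by
  obtain ⟨X, X', hX0, hX0', hX, hX', hb⟩ := exists_even_solution
  have hcX : ∀ z ∈ lawDom, ContinuousAt (fun z : ℝ × ℝ => X z.1) z := fun z hz =>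
    ContinuousAt.comp (f := Prod.fst) (hX z.1 hz.1).continuousAt continuousAt_fst
  have hcX' : ∀ z ∈ lawDom, ContinuousAt (fun z : ℝ × ℝ => X' z.1) z := fun z hz =>
    ContinuousAt.comp (f := Prod.fst) (hX' z.1 hz.1).continuousAt continuousAt_fst
  refine ⟨fun z => (1 + z.2) ^ 3 * ((2 * z.1 * X z.1 - (1 + z.1 ^ 2) * X' z.1) / 6),
    fun z => ((1 + z.2) ^ 2 * ((1 + z.1 ^ 2) * X z.1) - 1) / 2, fun z => (1 + z.2) ^ 3 * X z.1,
    fun z => (1 + z.2) ^ 2 * (2 * z.1 * X z.1 - (1 + z.1 ^ 2) * X' z.1) / 2,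
    ⟨fun z hz => ?_, fun z hz => ?_, fun z hz => ContinuousAt.continuousWithinAt ?_,
      fun z hz => ContinuousAt.continuousWithinAt ?_, fun z hz => ?_, by simp [hX0'],
      by simp [hX0]⟩, fun z hz hzb => ?_⟩
  · have h0 : 1 + z.1 ^ 2 ≠ 0 := by positivity
    have h1 : HasDerivAt (fun x : ℝ => (2 * x * X x - (1 + x ^ 2) * X' x) / 6) (X z.1) z.1 := by
      refine (((((hasDerivAt_id z.1).const_mul 2).mul (hX _ hz.1)).sub
        (((hasDerivAt_pow 2 z.1).const_add 1).mul (hX' _ hz.1))).div_const 6).congr_deriv ?_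
      simp
      field_simp
      ring
    have h2 : HasDerivAt (fun y : ℝ => (1 + y) ^ 3) (3 * (1 + z.2) ^ 2) z.2 := by
      exact (((hasDerivAt_id z.2).const_add 1).pow 3).congr_deriv (by simp)
    refine ((h2.comp_hasFDerivAt z (hasFDerivAt_snd (𝕜 := ℝ))).mul
      (h1.comp_hasFDerivAt z (hasFDerivAt_fst (𝕜 := ℝ)))).congr_fderiv ?_
    ext
    · simp
    · simp
      ring
  · have hQ : (1 : ℝ) + z.2 ≠ 0 := by linarith [hz.2]
    have h1 : HasDerivAt (fun x : ℝ => (1 + x ^ 2) * X x)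
        (2 * z.1 * X z.1 + (1 + z.1 ^ 2) * X' z.1) z.1 := by
      exact (((hasDerivAt_pow 2 z.1).const_add 1).mul (hX _ hz.1)).congr_deriv (by simp)
    have h2 : HasDerivAt (fun y : ℝ => (1 + y) ^ 2) (2 * (1 + z.2)) z.2 := by
      exact (((hasDerivAt_id z.2).const_add 1).pow 2).congr_deriv (by simp)
    have h3 := (((h2.comp_hasFDerivAt z (hasFDerivAt_snd (𝕜 := ℝ))).mul
      (h1.comp_hasFDerivAt z (hasFDerivAt_fst (𝕜 := ℝ)))).sub_const 1).mul_const (2⁻¹ : ℝ)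
    simp only [div_eq_mul_inv _ (2 : ℝ)]
    refine h3.congr_fderiv ?_
    ext
    · simp
      field_simp
      ring
    · simp
      field_simp
  · exact ((continuousAt_const.add continuousAt_snd).pow 3).mul (hcX z hz)
  · exact (((continuousAt_const.add continuousAt_snd).pow 2).mul
      (((continuousAt_const.mul continuousAt_fst).mul (hcX z hz)).sub
        ((continuousAt_const.add (continuousAt_fst.pow 2)).mul (hcX' z hz)))).div_const 2
  · obtain ⟨h1, h2⟩ := abs_le_of_mem_gradDisc hz
    have : 0 < 1 + z.2 := by linarith [(abs_le.1 h2).1]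
    have := (hb z.1 h1).1
    positivity
  · have h1 : (1 + z.2) ^ 2 = 1 + z.1 ^ 2 := by
      rw [hzb, add_sub_cancel, Real.sq_sqrt (by positivity)]
    have h2 := (hb z.1 (abs_le_of_mem_gradDisc hz).1).2
    beta_reduce
    rw [h1]
    nlinarith

theorem hasDerivAt_max_zero_sq (t : ℝ) : HasDerivAt (fun t : ℝ => max t 0 ^ 2) (2 * max t 0) t := by
  rcases lt_trichotomy t 0 with ht | rfl | ht
  · rw [max_eq_right ht.le, mul_zero]
    refine (hasDerivAt_const t (0 : ℝ)).congr_of_eventuallyEq ?_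
    filter_upwards [gt_mem_nhds ht] with s hs
    simp [max_eq_right (le_of_lt hs)]
  · rw [hasDerivAt_iff_isLittleO]
    simp only [max_self, mul_zero, smul_zero, sub_zero, ne_eq, OfNat.ofNat_ne_zero,
      not_false_eq_true, zero_pow]
    refine Asymptotics.IsBigO.trans_isLittleO (g := fun x : ℝ => x ^ 2) ?_
      (Asymptotics.isLittleO_pow_id one_lt_two)
    refine Asymptotics.isBigO_of_le _ fun x => ?_
    rw [norm_pow, norm_pow]
    refine pow_le_pow_left₀ (norm_nonneg _) ?_ 2
    rw [Real.norm_eq_abs, Real.norm_eq_abs, abs_of_nonneg (le_max_right _ _)]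
    exact max_le (le_abs_self x) (abs_nonneg x)
  · rw [max_eq_left ht.le]
    refine ((hasDerivAt_pow 2 t).congr_deriv (by simp)).congr_of_eventuallyEq ?_
    filter_upwards [lt_mem_nhds ht] with s hs
    simp [max_eq_left (le_of_lt hs)]

/-- The exterior half-plane domain in coordinates. -/
def extPlane : Set (ℝ × ℝ) := {z | 0 ≤ z.2 ∧ 1 ≤ z.1 ^ 2 + z.2 ^ 2}

/-- A solution `u` of the planar hodograph problem in coordinates, with gradient `(p, q)` and second
derivatives `a, b, c`, all living on the neighborhood `O` of the exterior domain. -/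
structure PlaneSol (O : Set (ℝ × ℝ)) (u p q a b c : ℝ × ℝ → ℝ) : Prop where
  isOpen : IsOpen O
  subset : extPlane ⊆ O
  deriv_u : ∀ z ∈ O, HasFDerivAt u
    (p z • ContinuousLinearMap.fst ℝ ℝ ℝ + q z • ContinuousLinearMap.snd ℝ ℝ ℝ) z
  deriv_p : ∀ z ∈ O, HasFDerivAt p
    (a z • ContinuousLinearMap.fst ℝ ℝ ℝ + b z • ContinuousLinearMap.snd ℝ ℝ ℝ) z
  deriv_q : ∀ z ∈ O, HasFDerivAt q
    (b z • ContinuousLinearMap.fst ℝ ℝ ℝ + c z • ContinuousLinearMap.snd ℝ ℝ ℝ) z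
  eqn : ∀ z ∈ extPlane, 0 < z.2 →
    a z + 2 * p z / (1 + q z) * b z + (1 + p z ^ 2) / (1 + q z) ^ 2 * c z = 0
  bdry : ∀ z ∈ extPlane, z.2 = 0 → q z = √(1 + p z ^ 2) - 1
  grad_mem : ∀ z ∈ extPlane, (p z, q z) ∈ gradDisc

/-- The truncation `(s u - k)₊`, extended by zero into the unit half disc. -/
def extTrunc (u : ℝ × ℝ → ℝ) (s k : ℝ) (z : ℝ × ℝ) : ℝ :=
  open Classical in if 1 ≤ z.1 ^ 2 + z.2 ^ 2 then max (s * u z - k) 0 else 0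

theorem extTrunc_nonneg (u : ℝ × ℝ → ℝ) (s k : ℝ) (z : ℝ × ℝ) : 0 ≤ extTrunc u s k z := by
  unfold extTrunc
  split_ifs
  · exact le_max_right _ _
  · exact le_rfl

theorem extTrunc_eq_zero_or_mem (u : ℝ × ℝ → ℝ) (s k : ℝ) {z : ℝ × ℝ} (hz : 0 ≤ z.2) :
    extTrunc u s k z = 0 ∨ z ∈ extPlane := by
  by_cases h : 1 ≤ z.1 ^ 2 + z.2 ^ 2
  · exact Or.inr ⟨hz, h⟩
  · exact Or.inl (if_neg h)

theorem extTrunc_of_mem (u : ℝ × ℝ → ℝ) (s k : ℝ) {z : ℝ × ℝ} (hz : z ∈ extPlane) :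
    extTrunc u s k z = max (s * u z - k) 0 := if_pos hz.2

namespace PlaneSol

variable {O : Set (ℝ × ℝ)} {u p q a b c f g lam kap : ℝ × ℝ → ℝ} {s k M : ℝ}

theorem extTrunc_local (h : PlaneSol O u p q a b c)
    (hk : ∀ z ∈ extPlane, z.1 ^ 2 + z.2 ^ 2 = 1 → s * u z < k) {z : ℝ × ℝ} (hz : 0 ≤ z.2) :
    (∀ᶠ w in nhds z, extTrunc u s k w = 0) ∨
      z ∈ extPlane ∧ ∀ᶠ w in nhds z, extTrunc u s k w = max (s * u w - k) 0 := by
  have hcont : Continuous fun w : ℝ × ℝ => w.1 ^ 2 + w.2 ^ 2 := by fun_prop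
  rcases lt_trichotomy (z.1 ^ 2 + z.2 ^ 2) 1 with h1 | h1 | h1
  · left
    filter_upwards [hcont.continuousAt.eventually (gt_mem_nhds h1)] with w hw
    exact if_neg (not_le.2 hw)
  · left
    have hzD : z ∈ extPlane := ⟨hz, h1.ge⟩
    have hc : ContinuousAt (fun w => s * u w) z :=
      continuousAt_const.mul (h.deriv_u z (h.subset hzD)).continuousAt
    filter_upwards [hc.eventually (gt_mem_nhds (hk z hzD h1))] with w hw
    unfold extTrunc
    split_ifs
    · exact max_eq_right (sub_nonpos.2 (le_of_lt hw))
    · rfl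
  · refine Or.inr ⟨⟨hz, h1.le⟩, ?_⟩
    filter_upwards [hcont.continuousAt.eventually (lt_mem_nhds h1)] with w hw
    exact if_pos (le_of_lt hw)

theorem hasFDerivAt_extTrunc_sq (h : PlaneSol O u p q a b c)
    (hk : ∀ z ∈ extPlane, z.1 ^ 2 + z.2 ^ 2 = 1 → s * u z < k) {z : ℝ × ℝ} (hz : 0 ≤ z.2) :
    HasFDerivAt (fun w => extTrunc u s k w ^ 2) ((2 * extTrunc u s k z * s) •
      (p z • ContinuousLinearMap.fst ℝ ℝ ℝ + q z • ContinuousLinearMap.snd ℝ ℝ ℝ)) z := by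
  rcases h.extTrunc_local hk hz with hloc | ⟨hzD, hloc⟩
  · rw [hloc.self_of_nhds, mul_zero, zero_mul, zero_smul]
    refine (hasFDerivAt_const (0 : ℝ) z).congr_of_eventuallyEq ?_
    filter_upwards [hloc] with w hw
    simp [hw]
  · rw [hloc.self_of_nhds, mul_smul]
    refine HasFDerivAt.congr_of_eventuallyEq (f := fun w => max (s * u w - k) 0 ^ 2) ?_ ?_
    · exact (hasDerivAt_max_zero_sq (s * u z - k)).comp_hasFDerivAt z
        (((h.deriv_u z (h.subset hzD)).const_mul s).sub_const k)
    · filter_upwards [hloc] with w hw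
      rw [hw]

theorem hasFDerivAt_comp_grad (h : PlaneSol O u p q a b c) {F : ℝ × ℝ → ℝ} {α β : ℝ} {z : ℝ × ℝ}
    (hz : z ∈ extPlane) (hF : HasFDerivAt F
      (α • ContinuousLinearMap.fst ℝ ℝ ℝ + β • ContinuousLinearMap.snd ℝ ℝ ℝ) (p z, q z)) :
    HasFDerivAt (fun w => F (p w, q w))
      ((α * a z + β * b z) • ContinuousLinearMap.fst ℝ ℝ ℝ +
        (α * b z + β * c z) • ContinuousLinearMap.snd ℝ ℝ ℝ) z := by
  have hO := h.subset hz
  refine (hF.comp z ((h.deriv_p z hO).prodMk (h.deriv_q z hO))).congr_fderiv ?_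
  ext <;> simp

/-- The truncated flux has an explicit divergence. -/
theorem exists_flux_deriv (h : PlaneSol O u p q a b c) (hl : GradLaw f g lam kap) (hs : s ^ 2 = 1)
    (hk : ∀ z ∈ extPlane, z.1 ^ 2 + z.2 ^ 2 = 1 → s * u z < k) {z : ℝ × ℝ} (hz : 0 ≤ z.2) :
    ∃ L₁ L₂ : ℝ × ℝ →L[ℝ] ℝ,
      HasFDerivAt (fun w => extTrunc u s k w ^ 2 * (s * f (p w, q w))) L₁ z ∧
      HasFDerivAt (fun w => extTrunc u s k w ^ 2 * (s * g (p w, q w))) L₂ z ∧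
      (0 < z.2 → L₁ (1, 0) + L₂ (0, 1) =
        2 * extTrunc u s k z * (p z * f (p z, q z) + q z * g (p z, q z))) ∧
      ContinuousAt (fun w => 2 * extTrunc u s k w * (p w * f (p w, q w) + q w * g (p w, q w)))
        z := by
  have hW := h.hasFDerivAt_extTrunc_sq hk hz
  rcases h.extTrunc_local hk hz with hloc | ⟨hzD, hloc⟩
  · have hzero : ∀ F : ℝ × ℝ → ℝ,
        HasFDerivAt (fun w => extTrunc u s k w ^ 2 * F w) (0 : ℝ × ℝ →L[ℝ] ℝ) z := fun F => by
      refine (hasFDerivAt_const (0 : ℝ) z).congr_of_eventuallyEq ?_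
      filter_upwards [hloc] with w hw
      simp [hw]
    refine ⟨0, 0, hzero _, hzero _, fun _ => by simp [hloc.self_of_nhds], ?_⟩
    refine (continuousAt_const (y := (0 : ℝ))).congr ?_
    filter_upwards [hloc] with w hw
    simp [hw]
  · have hP := gradDisc_subset_lawDom (h.grad_mem z hzD)
    have hf := h.hasFDerivAt_comp_grad hzD (hl.hasFDerivAt_f _ hP)
    have hg := h.hasFDerivAt_comp_grad hzD (hl.hasFDerivAt_g _ hP)
    refine ⟨_, _, hW.mul (hf.const_mul s), hW.mul (hg.const_mul s), fun hz0 => ?_, ?_⟩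
    · have he := h.eqn z hzD hz0
      simp
      linear_combination (2 * extTrunc u s k z * (p z * f (p z, q z) + q z * g (p z, q z))) * hs +
        extTrunc u s k z ^ 2 * s * lam (p z, q z) * he
    · have hO := h.subset hzD
      have hcu := (h.deriv_u z hO).continuousAt
      have hcp := (h.deriv_p z hO).continuousAt
      have hcq := (h.deriv_q z hO).continuousAt
      have hcτ : ContinuousAt (fun w => extTrunc u s k w) z := by
        refine ContinuousAt.congr (f := fun w => max (s * u w - k) 0) (by fun_prop) ?_
        filter_upwards [hloc] with w hw
        rw [hw]
      exact (continuousAt_const.mul hcτ).mul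
        ((hcp.mul hf.continuousAt).add (hcq.mul hg.continuousAt))

/-- A solution that is bounded above and lies below `k` on the unit half circle lies below `k`. -/
theorem le_of_lt_on_circle (h : PlaneSol O u p q a b c) (hl : GradLaw f g lam kap) (hs : s ^ 2 = 1)
    (hflux : ∀ z ∈ gradDisc, z.2 = √(1 + z.1 ^ 2) - 1 → 0 ≤ s * g z)
    (hM : ∀ z ∈ extPlane, s * u z ≤ M)
    (hk : ∀ z ∈ extPlane, z.1 ^ 2 + z.2 ^ 2 = 1 → s * u z < k) :
    ∀ z ∈ extPlane, s * u z ≤ k := by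
  obtain ⟨C, hC, hcoer⟩ := hl.exists_coercivity
  have hpos : ∀ z ∈ extPlane, 0 ≤ p z * f (p z, q z) + q z * g (p z, q z) := fun z hz => by
    have h1 := (hcoer _ (h.grad_mem z hz)).2
    have h2 : 0 ≤ C * (p z * f (p z, q z) + q z * g (p z, q z)) := le_trans (by positivity) h1
    exact nonneg_of_mul_nonneg_right h2 hC
  have hfield : CoerciveField (fun w => extTrunc u s k w ^ 2 * (s * f (p w, q w)))
      (fun w => extTrunc u s k w ^ 2 * (s * g (p w, q w)))
      (fun w => 2 * extTrunc u s k w * (p w * f (p w, q w) + q w * g (p w, q w)))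
      (C * max (M - k) 0 ^ 3 / 2 + 1) := by
    have hE : ∀ z : ℝ × ℝ, 0 ≤ z.2 →
        0 ≤ 2 * extTrunc u s k z * (p z * f (p z, q z) + q z * g (p z, q z)) := fun z hz => by
      rcases extTrunc_eq_zero_or_mem u s k hz with h0 | hzD
      · simp [h0]
      · exact mul_nonneg (mul_nonneg two_pos.le (extTrunc_nonneg u s k z)) (hpos z hzD)
    refine ⟨fun z hz => ?_, fun z hz => ?_, fun z hz => ?_, fun z hz => ?_, fun z hz => ?_,
      fun z hz => ?_, hE, fun z hz => ?_, fun x => ?_⟩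
    · obtain ⟨L₁, L₂, h1, h2, h3, h4⟩ := h.exists_flux_deriv hl hs hk hz
      exact h1.continuousAt.continuousWithinAt
    · obtain ⟨L₁, L₂, h1, h2, h3, h4⟩ := h.exists_flux_deriv hl hs hk hz
      exact h2.continuousAt.continuousWithinAt
    · obtain ⟨L₁, L₂, h1, h2, h3, h4⟩ := h.exists_flux_deriv hl hs hk hz
      exact h4.continuousWithinAt
    · obtain ⟨L₁, L₂, h1, h2, h3, h4⟩ := h.exists_flux_deriv hl hs hk hz.le
      exact h1.differentiableAt
    · obtain ⟨L₁, L₂, h1, h2, h3, h4⟩ := h.exists_flux_deriv hl hs hk hz.le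
      exact h2.differentiableAt
    · obtain ⟨L₁, L₂, h1, h2, h3, h4⟩ := h.exists_flux_deriv hl hs hk hz.le
      rw [h1.fderiv, h2.fderiv, h3 hz]
    · have hE0 := hE z hz
      rcases extTrunc_eq_zero_or_mem u s k hz with h0 | hzD
      · simp [h0]
      · have hτM : extTrunc u s k z ≤ max (M - k) 0 := by
          rw [extTrunc_of_mem u s k hzD]
          exact max_le_max (by linarith [hM z hzD]) le_rfl
        have hτ0 := extTrunc_nonneg u s k z
        have h1 := (hcoer _ (h.grad_mem z hzD)).1
        have h2 : extTrunc u s k z ^ 3 ≤ max (M - k) 0 ^ 3 := pow_le_pow_left₀ hτ0 hτM 3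
        set τ := extTrunc u s k z
        set Φ := p z * f (p z, q z) + q z * g (p z, q z)
        calc (τ ^ 2 * (s * f (p z, q z))) ^ 2 + (τ ^ 2 * (s * g (p z, q z))) ^ 2
            = τ ^ 4 * (f (p z, q z) ^ 2 + g (p z, q z) ^ 2) := by
              linear_combination τ ^ 4 * (f (p z, q z) ^ 2 + g (p z, q z) ^ 2) * hs
          _ ≤ τ ^ 4 * (C * Φ) := mul_le_mul_of_nonneg_left h1 (by positivity)
          _ = C * τ ^ 3 / 2 * (2 * τ * Φ) := by ring
          _ ≤ C * max (M - k) 0 ^ 3 / 2 * (2 * τ * Φ) := by gcongr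
          _ ≤ (C * max (M - k) 0 ^ 3 / 2 + 1) * (2 * τ * Φ) := by linarith
    · rcases extTrunc_eq_zero_or_mem u s k (z := (x, 0)) le_rfl with h0 | hzD
      · simp [h0]
      · exact mul_nonneg (sq_nonneg _)
          (hflux _ (h.grad_mem _ hzD) (h.bdry _ hzD rfl))
  have hCpos : 0 < C * max (M - k) 0 ^ 3 / 2 + 1 := by positivity
  have hderiv : ∀ z : ℝ × ℝ, 0 < z.2 →
      HasFDerivAt (fun w => extTrunc u s k w ^ 2) (0 : ℝ × ℝ →L[ℝ] ℝ) z := fun z hz => by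
    refine (h.hasFDerivAt_extTrunc_sq hk hz.le).congr_fderiv ?_
    have hE0 := hfield.eq_zero hCpos hz
    rcases extTrunc_eq_zero_or_mem u s k hz.le with h0 | hzD
    · simp [h0]
    · rcases mul_eq_zero.1 hE0 with h0 | h0
      · simp [h0]
      · have h1 := (hcoer _ (h.grad_mem z hzD)).2
        simp only [h0, mul_zero] at h1
        have hp : p z = 0 := by nlinarith [sq_nonneg (p z), sq_nonneg (q z)]
        have hq : q z = 0 := by nlinarith [sq_nonneg (p z), sq_nonneg (q z)]
        simp [hp, hq]
  have hopen : IsOpen {z : ℝ × ℝ | 0 < z.2} := isOpen_lt continuous_const continuous_snd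
  have hconv : Convex ℝ {z : ℝ × ℝ | 0 < z.2} :=
    convex_halfSpace_gt (ContinuousLinearMap.snd ℝ ℝ ℝ).toLinearMap.isLinear 0
  have hzero : ∀ z : ℝ × ℝ, 0 < z.2 → extTrunc u s k z ^ 2 = 0 := fun z hz => by
    have h1 : extTrunc u s k z ^ 2 = extTrunc u s k ((0, 1 / 2) : ℝ × ℝ) ^ 2 :=
      hopen.is_const_of_fderiv_eq_zero hconv.isPreconnected
        (fun w hw => (hderiv w hw).differentiableAt.differentiableWithinAt)
        (fun w hw => (hderiv w hw).fderiv) hz (show (0 : ℝ) < 1 / 2 by norm_num)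
    rw [h1, extTrunc, if_neg (by norm_num)]
    norm_num
  intro z hz
  have hz0 : extTrunc u s k z ^ 2 = 0 := by
    have hc := (h.hasFDerivAt_extTrunc_sq hk hz.1).continuousAt
    have hpath : Tendsto (fun t : ℝ => z + (0, t)) (nhdsWithin 0 (Ioi 0)) (nhds z) := by
      have : ContinuousAt (fun t : ℝ => z + (0, t)) 0 := by fun_prop
      have h0 : z + ((0 : ℝ), (0 : ℝ)) = z := by ext <;> simp
      rw [ContinuousAt, h0] at this
      exact this.mono_left nhdsWithin_le_nhds
    refine tendsto_nhds_unique (hc.tendsto.comp hpath) ?_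
    refine tendsto_const_nhds.congr' ?_
    filter_upwards [self_mem_nhdsWithin] with t ht
    exact (hzero _ (add_pos_of_nonneg_of_pos hz.1 ht)).symm
  have h1 : extTrunc u s k z = 0 := by simpa using hz0
  rw [extTrunc_of_mem u s k hz] at h1
  linarith [le_max_left (s * u z - k) 0]

end PlaneSol

/-- The linear coordinates on the euclidean plane. -/
def planeEmb : ℝ × ℝ →L[ℝ] EuclideanSpace ℝ (Fin 2) :=
  (ContinuousLinearMap.fst ℝ ℝ ℝ).smulRight (EuclideanSpace.single 0 1) +
    (ContinuousLinearMap.snd ℝ ℝ ℝ).smulRight (EuclideanSpace.single 1 1)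

theorem planeEmb_apply (z : ℝ × ℝ) : planeEmb z =
    z.1 • EuclideanSpace.single (0 : Fin 2) (1 : ℝ) +
      z.2 • EuclideanSpace.single (1 : Fin 2) (1 : ℝ) := by
  simp [planeEmb]

theorem planeEmb_apply_zero (z : ℝ × ℝ) : planeEmb z 0 = z.1 := by simp [planeEmb_apply]

theorem planeEmb_apply_one (z : ℝ × ℝ) : planeEmb z 1 = z.2 := by simp [planeEmb_apply]

theorem planeEmb_coords (y : EuclideanSpace ℝ (Fin 2)) : planeEmb (y 0, y 1) = y := by
  ext i
  fin_cases i
  · exact planeEmb_apply_zero _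
  · exact planeEmb_apply_one _

theorem norm_planeEmb (z : ℝ × ℝ) : ‖planeEmb z‖ = √(z.1 ^ 2 + z.2 ^ 2) := by
  rw [EuclideanSpace.norm_eq]
  simp [Fin.sum_univ_two, planeEmb_apply_zero, planeEmb_apply_one]

theorem planeEmb_mem_extDom {z : ℝ × ℝ} (hd : 0 < 2) : planeEmb z ∈ extDom 2 hd ↔ z ∈ extPlane := by
  have h : planeEmb z (lastIdx 2 hd) = z.2 := planeEmb_apply_one z
  rw [extDom, extPlane, Set.mem_ofPred_eq, Set.mem_ofPred_eq, h, norm_planeEmb, Real.one_le_sqrt]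

theorem planeEmb_mem_upSphere {z : ℝ × ℝ} (hd : 0 < 2) (hz : z ∈ extPlane)
    (h1 : z.1 ^ 2 + z.2 ^ 2 = 1) : planeEmb z ∈ upSphere 2 hd 1 :=
  ⟨((planeEmb_mem_extDom hd).2 hz).1, by rw [norm_planeEmb, h1, Real.sqrt_one]⟩

theorem lastIdx_two (hd : 0 < 2) : lastIdx 2 hd = 1 := rfl

theorem tangSq_two (hd : 0 < 2) (p : Fin 2 → ℝ) : tangSq 2 hd p = p 0 ^ 2 := by
  simp [tangSq, lastIdx_two, Fin.sum_univ_two]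

theorem hodOp_two (hd : 0 < 2) (v : EuclideanSpace ℝ (Fin 2) → ℝ) (y : EuclideanSpace ℝ (Fin 2)) :
    hodOp 2 hd v y = hessC 2 v y 0 0 +
      gradC 2 v y 0 / (1 + gradC 2 v y 1) * (hessC 2 v y 0 1 + hessC 2 v y 1 0) +
      (1 + gradC 2 v y 0 ^ 2) / (1 + gradC 2 v y 1) ^ 2 * hessC 2 v y 1 1 := by
  simp [hodOp, hodA, lastIdx_two, tangSq_two, Fin.sum_univ_two]
  ring

theorem HasFDerivAt.comp_planeEmb {F : EuclideanSpace ℝ (Fin 2) → ℝ} {z : ℝ × ℝ}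
    (h : DifferentiableAt ℝ F (planeEmb z)) : HasFDerivAt (fun w => F (planeEmb w))
      (fderiv ℝ F (planeEmb z) (EuclideanSpace.single 0 1) • ContinuousLinearMap.fst ℝ ℝ ℝ +
        fderiv ℝ F (planeEmb z) (EuclideanSpace.single 1 1) • ContinuousLinearMap.snd ℝ ℝ ℝ) z := by
  refine (h.hasFDerivAt.comp z planeEmb.hasFDerivAt).congr_fderiv ?_
  ext <;> simp [planeEmb]

theorem hessC_comm {v : EuclideanSpace ℝ (Fin 2) → ℝ} {y : EuclideanSpace ℝ (Fin 2)}
    (h : ContDiffAt ℝ 2 v y) (i j : Fin 2) : hessC 2 v y i j = hessC 2 v y j i := by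
  have hd : DifferentiableAt ℝ (fderiv ℝ v) y :=
    (h.fderiv_right (m := 1) (by norm_num)).differentiableAt (by norm_num)
  have key : ∀ a b : Fin 2, hessC 2 v y a b = fderiv ℝ (fderiv ℝ v) y (EuclideanSpace.single b 1)
      (EuclideanSpace.single a 1) := fun a b => by
    rw [hessC, fderiv_clm_apply hd (differentiableAt_const _)]
    simp
  rw [key, key]
  exact (h.isSymmSndFDerivAt (by simp)) _ _

theorem grad_mem_gradDisc {L : EuclideanSpace ℝ (Fin 2) →L[ℝ] ℝ} (hL : ‖L‖ ≤ 1 / 2) :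
    (L (EuclideanSpace.single 0 1), L (EuclideanSpace.single 1 1)) ∈ gradDisc := by
  set a := L (EuclideanSpace.single 0 1)
  set b := L (EuclideanSpace.single 1 1)
  have h1 : L (planeEmb (a, b)) = a ^ 2 + b ^ 2 := by
    rw [planeEmb_apply, map_add, map_smul, map_smul, smul_eq_mul, smul_eq_mul, sq, sq]
  have h2 : a ^ 2 + b ^ 2 ≤ 1 / 2 * √(a ^ 2 + b ^ 2) := by
    calc a ^ 2 + b ^ 2 = L (planeEmb (a, b)) := h1.symm
      _ ≤ ‖L (planeEmb (a, b))‖ := le_abs_self _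
      _ ≤ ‖L‖ * ‖planeEmb (a, b)‖ := L.le_opNorm _
      _ ≤ 1 / 2 * ‖planeEmb (a, b)‖ := by gcongr
      _ = _ := by rw [norm_planeEmb]
  have h3 := Real.sq_sqrt (show 0 ≤ a ^ 2 + b ^ 2 by positivity)
  change a ^ 2 + b ^ 2 ≤ 1 / 4
  nlinarith [Real.sqrt_nonneg (a ^ 2 + b ^ 2), sq_nonneg (√(a ^ 2 + b ^ 2) - 1 / 2)]

theorem IsHodSol.exists_planeSol {v : EuclideanSpace ℝ (Fin 2) → ℝ} {hd : 0 < 2}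
    (hsol : IsHodSol 2 hd v (extDom 2 hd)) (hgrad : ∀ y ∈ extDom 2 hd, ‖fderiv ℝ v y‖ ≤ 1 / 2) :
    ∃ O p q a b c, PlaneSol O (fun z => v (planeEmb z)) p q a b c := by
  obtain ⟨⟨W, hWo, hsub, hv⟩, heq, hbd⟩ := hsol
  have hv2 : ∀ y ∈ W, ContDiffAt ℝ 2 v y := fun y hy =>
    ((hv y hy).contDiffAt (hWo.mem_nhds hy)).of_le (by norm_cast)
  have hg : ∀ y ∈ W, ∀ i : Fin 2,
      DifferentiableAt ℝ (fun x => fderiv ℝ v x (EuclideanSpace.single i 1)) y := fun y hy i =>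
    (((hv2 y hy).fderiv_right (m := 1) (by norm_num)).differentiableAt (by norm_num)).clm_apply
      (differentiableAt_const _)
  refine ⟨planeEmb ⁻¹' W, fun z => gradC 2 v (planeEmb z) 0, fun z => gradC 2 v (planeEmb z) 1,
    fun z => hessC 2 v (planeEmb z) 0 0, fun z => hessC 2 v (planeEmb z) 0 1,
    fun z => hessC 2 v (planeEmb z) 1 1, hWo.preimage planeEmb.continuous,
    fun z hz => hsub ((planeEmb_mem_extDom hd).2 hz), fun z hz => ?_, fun z hz => ?_,
    fun z hz => ?_, fun z hz hz0 => ?_, fun z hz hz0 => ?_, fun z hz => ?_⟩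
  · exact HasFDerivAt.comp_planeEmb ((hv2 _ hz).differentiableAt (by norm_num))
  · exact HasFDerivAt.comp_planeEmb (hg _ hz 0)
  · rw [hessC_comm (hv2 _ hz) 0 1]
    exact HasFDerivAt.comp_planeEmb (hg _ hz 1)
  · have hzD := (planeEmb_mem_extDom hd).2 hz
    have h1 := heq _ hzD (hz0.trans_eq (planeEmb_apply_one z).symm)
    rw [hodOp_two, hessC_comm (hv2 _ (hsub hzD)) 1 0] at h1
    linear_combination h1
  · have h1 := hbd _ ((planeEmb_mem_extDom hd).2 hz) ((planeEmb_apply_one z).trans hz0)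
    rw [hodN, tangSq_two] at h1
    exact h1
  · exact grad_mem_gradDisc (hgrad _ ((planeEmb_mem_extDom hd).2 hz))

theorem upSphere_subset_extDom (d : ℕ) (hd : 0 < d) : upSphere d hd 1 ⊆ extDom d hd :=
  fun _ hy => ⟨hy.1, hy.2.ge⟩

theorem upSphere_two_nonempty (hd : 0 < 2) : (upSphere 2 hd 1).Nonempty :=
  ⟨planeEmb (1, 0), planeEmb_mem_upSphere hd (by norm_num [extPlane]) (by norm_num)⟩

/-- If `s = ±1` and some conservation law has boundary flux of sign `s`, then `s * v` is bounded on
the exterior domain by any bound on the unit half circle. -/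
theorem IsHodSol.mul_le_of_upSphere {v : EuclideanSpace ℝ (Fin 2) → ℝ} {hd : 0 < 2}
    (hsol : IsHodSol 2 hd v (extDom 2 hd)) (hgrad : ∀ y ∈ extDom 2 hd, ‖fderiv ℝ v y‖ ≤ 1 / 2)
    {f g lam kap : ℝ × ℝ → ℝ} (hl : GradLaw f g lam kap) {s M m : ℝ} (hs : s ^ 2 = 1)
    (hflux : ∀ z ∈ gradDisc, z.2 = √(1 + z.1 ^ 2) - 1 → 0 ≤ s * g z)
    (hM : ∀ y ∈ extDom 2 hd, s * v y ≤ M) (hm : ∀ y ∈ upSphere 2 hd 1, s * v y ≤ m) :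
    ∀ y ∈ extDom 2 hd, s * v y ≤ m := by
  obtain ⟨O, p, q, a, b, c, hP⟩ := hsol.exists_planeSol hgrad
  intro y hy
  refine le_of_forall_gt_imp_ge_of_dense fun k hk => ?_
  rw [← planeEmb_coords y] at hy ⊢
  exact hP.le_of_lt_on_circle hl hs hflux (fun z hz => hM _ ((planeEmb_mem_extDom hd).2 hz))
    (fun z hz h1 => (hm _ (planeEmb_mem_upSphere hd hz h1)).trans_lt hk) _
    ((planeEmb_mem_extDom hd).1 hy)

/-- Maximum principle for one-sided bounded exterior solutions in `d = 2`: the extremum over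
`H₁` is attained on `∂B₁⁺`. -/
theorem stmt8 (v : EuclideanSpace ℝ (Fin 2) → ℝ)
    (hsol : IsHodSol 2 (by norm_num) v (extDom 2 (by norm_num)))
    (hgrad : ∀ y ∈ extDom 2 (by norm_num), ‖fderiv ℝ v y‖ ≤ 1 / 2) :
    ((∃ m : ℝ, ∀ y ∈ extDom 2 (by norm_num), m ≤ v y) →
      sInf (v '' extDom 2 (by norm_num)) = sInf (v '' upSphere 2 (by norm_num) 1)) ∧
    ((∃ M : ℝ, ∀ y ∈ extDom 2 (by norm_num), v y ≤ M) →
      sSup (v '' extDom 2 (by norm_num)) = sSup (v '' upSphere 2 (by norm_num) 1)) := by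
  have hsub := upSphere_subset_extDom 2 (by norm_num)
  have hne := (upSphere_two_nonempty (by norm_num)).image v
  constructor
  · rintro ⟨m, hm⟩
    obtain ⟨f, g, lam, kap, hl, hg⟩ := exists_gradLaw_nonpos_flux
    have hbdd : BddBelow (v '' extDom 2 (by norm_num)) := ⟨m, forall_mem_image.2 hm⟩
    have hle := hsol.mul_le_of_upSphere hgrad hl (s := -1) (M := -m)
      (m := -sInf (v '' upSphere 2 (by norm_num) 1)) (by norm_num)
      (fun z hz h => by linarith [hg z hz h]) (fun y hy => by linarith [hm y hy])
      (fun y hy => by linarith [csInf_le (hbdd.mono (image_mono hsub)) (mem_image_of_mem v hy)])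
    refine le_antisymm (csInf_le_csInf hbdd hne (image_mono hsub))
      (le_csInf (hne.mono (image_mono hsub)) (forall_mem_image.2 fun y hy => ?_))
    linarith [hle y hy]
  · rintro ⟨M, hM⟩
    obtain ⟨f, g, lam, kap, hl, hg⟩ := exists_gradLaw_nonneg_flux
    have hbdd : BddAbove (v '' extDom 2 (by norm_num)) := ⟨M, forall_mem_image.2 hM⟩
    have hle := hsol.mul_le_of_upSphere hgrad hl (s := 1) (M := M)
      (m := sSup (v '' upSphere 2 (by norm_num) 1)) (by norm_num)
      (fun z hz h => by linarith [hg z hz h]) (fun y hy => by linarith [hM y hy])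
      (fun y hy => by linarith [le_csSup (hbdd.mono (image_mono hsub)) (mem_image_of_mem v hy)])
    refine le_antisymm (csSup_le (hne.mono (image_mono hsub)) (forall_mem_image.2 fun y hy => ?_))
      (csSup_le_csSup hbdd hne (image_mono hsub))
    linarith [hle y hy]
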